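/- arXiv:1401.6847 — 3 statements merged into one kernel-verified Lean document; each statement's English description precedes it below -/
import Mathlib

section
/- Let M and M' be finitely generated abelian groups, let ⟨,⟩ : M × M' → ℚ be a ℚ-non-degenerate bilinear pairing, and let F : M → M and F' : M' → M' be endomorphisms that are adjoint for ⟨,⟩ and such that F is ℚ-semi-simple. Then the restriction of ⟨,⟩ to M^F × M'^{F'} is ℚ-non-degenerate; in particular, the ranks of M^F and M'^{F'} are equal. -/
open scoped TensorProduct

/-- An endomorphism of a module is *semisimple* if every invariant subspace
admits an invariant complement. -/
def IsSemisimpleEnd {K V : Type} [Field K] [AddCommGroup V] [Module K V]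
    (f : V →ₗ[K] V) : Prop :=
  ∀ W : Submodule K V, W ≤ W.comap f → ∃ W' : Submodule K V, W' ≤ W'.comap f ∧ IsCompl W W'

noncomputable def ratPairing {A A' : Type} [AddCommGroup A] [AddCommGroup A']
    (b : A →ₗ[ℤ] A' →ₗ[ℤ] ℚ) : (ℚ ⊗[ℤ] A) →ₗ[ℚ] (ℚ ⊗[ℤ] A') →ₗ[ℚ] ℚ :=
  LinearMap.liftBaseChange ℚ
    ((LinearMap.liftBaseChangeEquiv (R := ℤ) (M := A') (N := ℚ) ℚ).toLinearMap.restrictScalars ℤ ∘ₗ b)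

lemma ratPairing_tmul {A A' : Type} [AddCommGroup A] [AddCommGroup A']
    (b : A →ₗ[ℤ] A' →ₗ[ℤ] ℚ) (p q : ℚ) (a : A) (a' : A') :
    ratPairing b (p ⊗ₜ a) (q ⊗ₜ a') = p * (q * b a a') := by
  simp [ratPairing]

lemma exists_int_smul_eq {A : Type} [AddCommGroup A] (v : ℚ ⊗[ℤ] A) :
    ∃ (n : ℤ) (a : A), n ≠ 0 ∧ (n : ℚ) • v = (1 : ℚ) ⊗ₜ[ℤ] a := by
  induction v with
  | zero => exact ⟨1, 0, one_ne_zero, by simp⟩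
  | tmul q a =>
    refine ⟨q.den, q.num • a, by simp, ?_⟩
    rw [TensorProduct.tmul_smul, TensorProduct.smul_tmul', TensorProduct.smul_tmul']
    congr 1
    simp [Rat.den_mul_eq_num]
  | add x y hx hy =>
    obtain ⟨n, a, hn, h⟩ := hx
    obtain ⟨k, c, hk, h'⟩ := hy
    refine ⟨n * k, k • a + n • c, mul_ne_zero hn hk, ?_⟩
    rw [TensorProduct.tmul_add, TensorProduct.tmul_smul, TensorProduct.tmul_smul, ← h, ← h',
      ← Int.cast_smul_eq_zsmul ℚ, ← Int.cast_smul_eq_zsmul ℚ, smul_smul, smul_smul, smul_add]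
    push_cast
    rw [mul_comm (k : ℚ)]

lemma one_tmul_eq_zero_iff {A : Type} [AddCommGroup A] (a : A) :
    (1 : ℚ) ⊗ₜ[ℤ] a = 0 ↔ a ∈ Submodule.torsion ℤ A := by
  have : IsLocalizedModule (nonZeroDivisors ℤ) (TensorProduct.mk ℤ ℚ A 1) :=
    (isLocalizedModule_iff_isBaseChange (nonZeroDivisors ℤ) ℚ _).2
      (TensorProduct.isBaseChange ℤ A ℚ)
  have h := IsLocalizedModule.eq_zero_iff (nonZeroDivisors ℤ) (TensorProduct.mk ℤ ℚ A 1) (m := a)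
  rw [TensorProduct.mk_apply] at h
  rw [h, Submodule.mem_torsion_iff]

lemma ratPairing_flip {A A' : Type} [AddCommGroup A] [AddCommGroup A']
    (b : A →ₗ[ℤ] A' →ₗ[ℤ] ℚ) (x : ℚ ⊗[ℤ] A) (y : ℚ ⊗[ℤ] A') :
    ratPairing b.flip y x = ratPairing b x y := by
  induction x with
  | zero => simp
  | add x z hx hz => simp [hx, hz]
  | tmul q a =>
    induction y with
    | zero => simp
    | add x z hx hz => simp [hx, hz]
    | tmul q a => rw [ratPairing_tmul, ratPairing_tmul, LinearMap.flip_apply]; ring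

lemma ratPairing_left {A A' : Type} [AddCommGroup A] [AddCommGroup A']
    (b : A →ₗ[ℤ] A' →ₗ[ℤ] ℚ)
    (h : ∀ a, (∀ a', b a a' = 0) → a ∈ Submodule.torsion ℤ A)
    (x : ℚ ⊗[ℤ] A) (hx : ∀ y, ratPairing b x y = 0) : x = 0 := by
  obtain ⟨n, a, hn, e⟩ := exists_int_smul_eq x
  have hn' : (n : ℚ) ≠ 0 := by exact_mod_cast hn
  refine (smul_eq_zero.1 (?_ : (n : ℚ) • x = 0)).resolve_left hn'
  rw [e, one_tmul_eq_zero_iff]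
  refine h a fun a' => ?_
  have := ratPairing_tmul b 1 1 a a'
  rw [← e, map_smul, LinearMap.smul_apply, hx] at this
  simpa using this.symm

lemma ratPairing_right {A A' : Type} [AddCommGroup A] [AddCommGroup A']
    (b : A →ₗ[ℤ] A' →ₗ[ℤ] ℚ)
    (h : ∀ a', (∀ a, b a a' = 0) → a' ∈ Submodule.torsion ℤ A')
    (y : ℚ ⊗[ℤ] A') (hy : ∀ x, ratPairing b x y = 0) : y = 0 :=
  ratPairing_left b.flip h y fun x => by rw [ratPairing_flip, hy]

lemma finrank_eq_of_sep {V V' : Type} [AddCommGroup V] [Module ℚ V] [AddCommGroup V'] [Module ℚ V']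
    [Module.Finite ℚ V] [Module.Finite ℚ V'] (P : V →ₗ[ℚ] V' →ₗ[ℚ] ℚ)
    (hl : ∀ x, (∀ y, P x y = 0) → x = 0) (hr : ∀ y, (∀ x, P x y = 0) → y = 0) :
    Function.Injective P.flip ∧ Module.finrank ℚ V = Module.finrank ℚ V' := by
  have i1 : Function.Injective P := (injective_iff_map_eq_zero P).2 fun x hx =>
    hl x fun y => by rw [hx]; rfl
  have i2 : Function.Injective P.flip := (injective_iff_map_eq_zero P.flip).2 fun x hx =>
    hr x fun y => by rw [← LinearMap.flip_apply, hx]; rfl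
  refine ⟨i2, le_antisymm ?_ ?_⟩
  · simpa [Subspace.dual_finrank_eq] using
      LinearMap.finrank_le_finrank_of_injective (f := (P : V →ₗ[ℚ] Module.Dual ℚ V')) i1
  · simpa [Subspace.dual_finrank_eq] using
      LinearMap.finrank_le_finrank_of_injective (f := (P.flip : V' →ₗ[ℚ] Module.Dual ℚ V)) i2

lemma linear_core {V V' : Type} [AddCommGroup V] [Module ℚ V] [AddCommGroup V'] [Module ℚ V']
    [Module.Finite ℚ V] [Module.Finite ℚ V'] (P : V →ₗ[ℚ] V' →ₗ[ℚ] ℚ)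
    (hl : ∀ x, (∀ y, P x y = 0) → x = 0) (hr : ∀ y, (∀ x, P x y = 0) → y = 0)
    (f : V →ₗ[ℚ] V) (f' : V' →ₗ[ℚ] V') (hadj : ∀ x y, P (f x) y = P x (f' y))
    (hss : IsSemisimpleEnd f) :
    (∀ x, f x = x → (∀ y, f' y = y → P x y = 0) → x = 0) ∧
    (∀ y, f' y = y → (∀ x, f x = x → P x y = 0) → y = 0) := by
  obtain ⟨hinj, hdim⟩ := finrank_eq_of_sep P hl hr
  have hsurj : Function.Surjective (P.flip : V' →ₗ[ℚ] Module.Dual ℚ V) :=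
    (LinearMap.injective_iff_surjective_of_finrank_eq_finrank
      (by rw [Subspace.dual_finrank_eq, hdim])).1 hinj
  set g : V →ₗ[ℚ] V := f - LinearMap.id with hg
  have hk : ∀ x, x ∈ LinearMap.ker g ↔ f x = x := fun x => by simp [hg, sub_eq_zero]
  obtain ⟨W, hW, hc⟩ := hss (LinearMap.ker g) (fun x hx => by
    have := (hk x).1 hx
    rw [Submodule.mem_comap, this]; exact hx)
  have hdec : ∀ x, ∃ k w, f k = k ∧ w ∈ W ∧ k + w = x := fun x => by
    have : x ∈ LinearMap.ker g ⊔ W := by rw [hc.sup_eq_top]; trivial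
    obtain ⟨k, hk', w, hw, e⟩ := Submodule.mem_sup.1 this
    exact ⟨k, w, (hk k).1 hk', hw, e⟩
  have hrange : LinearMap.range g ≤ W := by
    rintro _ ⟨x, rfl⟩
    obtain ⟨k, w, hk', hw, rfl⟩ := hdec x
    have : g (k + w) = f w - w := by simp [hg, hk']
    rw [this]
    exact W.sub_mem (hW hw) hw
  have hdisj : LinearMap.ker g ⊓ LinearMap.range g = ⊥ :=
    (hc.disjoint.mono_right hrange).eq_bot
  have hcompl : LinearMap.ker g ⊔ LinearMap.range g = ⊤ := by
    apply Submodule.eq_top_of_finrank_eq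
    have h1 := Submodule.finrank_sup_add_finrank_inf_eq (LinearMap.ker g) (LinearMap.range g)
    have h2 := LinearMap.finrank_range_add_finrank_ker g
    rw [hdisj, finrank_bot] at h1
    omega
  constructor
  · intro x hx h
    have hxr : x ∈ LinearMap.range g := by
      by_contra hn
      obtain ⟨φ, hφ, hle⟩ := Submodule.exists_le_ker_of_notMem hn
      obtain ⟨y, rfl⟩ := hsurj φ
      refine hφ (h y ?_)
      rw [← sub_eq_zero]
      refine hr _ fun z => ?_
      have : P (g z) y = 0 := hle ⟨z, rfl⟩
      rw [map_sub, ← hadj]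
      simpa [hg] using this
    have : x ∈ LinearMap.ker g ⊓ LinearMap.range g := ⟨(hk x).2 hx, hxr⟩
    rwa [hdisj, Submodule.mem_bot] at this
  · intro y hy h
    refine hr y fun x => ?_
    have : x ∈ LinearMap.ker g ⊔ LinearMap.range g := by rw [hcompl]; trivial
    obtain ⟨k, hk', _, ⟨z, rfl⟩, rfl⟩ := Submodule.mem_sup.1 this
    rw [map_add, LinearMap.add_apply, h k ((hk k).1 hk')]
    simp [hg, hadj, hy]

lemma fixed_descend {A : Type} [AddCommGroup A] (F : A →ₗ[ℤ] A) (x : ℚ ⊗[ℤ] A)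
    (hx : F.baseChange ℚ x = x) :
    ∃ (n : ℤ) (a : A), n ≠ 0 ∧ F a = a ∧ (n : ℚ) • x = (1 : ℚ) ⊗ₜ[ℤ] a := by
  obtain ⟨n, a, hn, e⟩ := exists_int_smul_eq x
  have h0 : (1 : ℚ) ⊗ₜ[ℤ] (F a - a) = 0 := by
    rw [TensorProduct.tmul_sub, ← LinearMap.baseChange_tmul, ← e, map_smul, hx, sub_self]
  rw [one_tmul_eq_zero_iff, Submodule.mem_torsion_iff] at h0
  obtain ⟨⟨k, hk⟩, h⟩ := h0
  replace h : k • (F a - a) = 0 := h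
  refine ⟨k * n, k • a, mul_ne_zero (nonZeroDivisors.ne_zero hk) hn, ?_, ?_⟩
  · rw [map_smul, ← sub_eq_zero, ← smul_sub, h]
  · rw [TensorProduct.tmul_smul, ← e, ← Int.cast_smul_eq_zsmul ℚ, smul_smul]
    push_cast; rfl

lemma torsion_sub {A : Type} [AddCommGroup A] (S : Submodule ℤ A) (a : S)
    (h : (a : A) ∈ Submodule.torsion ℤ A) : a ∈ Submodule.torsion ℤ S := by
  rw [Submodule.mem_torsion_iff] at h ⊢
  obtain ⟨k, h⟩ := h
  exact ⟨k, Subtype.ext h⟩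

/-- Let `M, M'` be finitely generated abelian groups with a `ℚ`-non-degenerate bilinear
pairing `B : M × M' → ℚ` (non-degeneracy after `⊗ℚ` is expressed by: any element pairing to
zero with everything is torsion), and let `F, F'` be endomorphisms adjoint for `B`, with
`F ⊗ ℚ` semisimple.  Then the restriction of `B` to `M^F × M'^{F'}` is `ℚ`-non-degenerate;
in particular `rk M^F = rk M'^{F'}`. -/
theorem restricted_pairing_nondegenerate {M M' : Type}
    [AddCommGroup M] [AddCommGroup M']
    [Module.Finite ℤ M] [Module.Finite ℤ M']
    (B : M → M' → ℚ)
    (hBl : ∀ (m₁ m₂ : M) (m' : M'), B (m₁ + m₂) m' = B m₁ m' + B m₂ m')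
    (hBr : ∀ (m : M) (m₁' m₂' : M'), B m (m₁' + m₂') = B m m₁' + B m m₂')
    (hndl : ∀ m : M, (∀ m' : M', B m m' = 0) → m ∈ Submodule.torsion ℤ M)
    (hndr : ∀ m' : M', (∀ m : M, B m m' = 0) → m' ∈ Submodule.torsion ℤ M')
    (F : M →ₗ[ℤ] M) (F' : M' →ₗ[ℤ] M')
    (hadj : ∀ (m : M) (m' : M'), B (F m) m' = B m (F' m'))
    (hss : IsSemisimpleEnd (F.baseChange ℚ))
    (MF : Submodule ℤ M) (hMF : MF = LinearMap.ker (F - LinearMap.id))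
    (MF' : Submodule ℤ M') (hMF' : MF' = LinearMap.ker (F' - LinearMap.id)) :
    (∀ m ∈ MF, (∀ m' ∈ MF', B m m' = 0) → m ∈ Submodule.torsion ℤ M) ∧
    (∀ m' ∈ MF', (∀ m ∈ MF, B m m' = 0) → m' ∈ Submodule.torsion ℤ M') ∧
    Module.finrank ℚ (ℚ ⊗[ℤ] ↥MF) = Module.finrank ℚ (ℚ ⊗[ℤ] ↥MF') := by
  let b : M →ₗ[ℤ] M' →ₗ[ℤ] ℚ :=
    (AddMonoidHom.mk' (fun m => (AddMonoidHom.mk' (B m) (hBr m)).toIntLinearMap)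
      (fun x y => by ext z; exact hBl x y z)).toIntLinearMap
  have hb : ∀ m m', b m m' = B m m' := fun _ _ => rfl
  have hP : ∀ x y, ratPairing b (F.baseChange ℚ x) y = ratPairing b x (F'.baseChange ℚ y) := by
    intro x y
    induction x with
    | zero => simp
    | add x z hx hz => simp only [map_add, LinearMap.add_apply, hx, hz]
    | tmul q a =>
      induction y with
      | zero => simp
      | add x z hx hz => simp only [map_add, hx, hz]
      | tmul r c =>
        rw [LinearMap.baseChange_tmul, LinearMap.baseChange_tmul, ratPairing_tmul,
          ratPairing_tmul, hb, hb, hadj]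
  obtain ⟨c1, c2⟩ := linear_core (ratPairing b) (ratPairing_left b hndl) (ratPairing_right b hndr)
    (F.baseChange ℚ) (F'.baseChange ℚ) hP hss
  have hm : ∀ m, m ∈ MF ↔ F m = m := fun m => by simp [hMF, sub_eq_zero]
  have hm' : ∀ m, m ∈ MF' ↔ F' m = m := fun m => by simp [hMF', sub_eq_zero]
  have r1 : ∀ m ∈ MF, (∀ m' ∈ MF', B m m' = 0) → m ∈ Submodule.torsion ℤ M := by
    intro m hmm h
    rw [← one_tmul_eq_zero_iff]
    refine c1 _ (by rw [LinearMap.baseChange_tmul, (hm m).1 hmm]) fun y hy => ?_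
    obtain ⟨n, a, hn, ha, e⟩ := fixed_descend F' y hy
    have hn' : (n : ℚ) ≠ 0 := by exact_mod_cast hn
    refine (smul_eq_zero.1 (?_ : (n : ℚ) • ratPairing b (1 ⊗ₜ[ℤ] m) y = 0)).resolve_left hn'
    rw [← map_smul, e, ratPairing_tmul, hb, h a ((hm' a).2 ha)]
    simp
  have r2 : ∀ m' ∈ MF', (∀ m ∈ MF, B m m' = 0) → m' ∈ Submodule.torsion ℤ M' := by
    intro m hmm h
    rw [← one_tmul_eq_zero_iff]
    refine c2 _ (by rw [LinearMap.baseChange_tmul, (hm' m).1 hmm]) fun y hy => ?_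
    obtain ⟨n, a, hn, ha, e⟩ := fixed_descend F y hy
    have hn' : (n : ℚ) ≠ 0 := by exact_mod_cast hn
    refine (smul_eq_zero.1 (?_ : (n : ℚ) • ratPairing b y (1 ⊗ₜ[ℤ] m) = 0)).resolve_left hn'
    rw [← LinearMap.smul_apply, ← map_smul, e, ratPairing_tmul, hb, h a ((hm a).2 ha)]
    simp
  refine ⟨r1, r2, ?_⟩
  let b' : MF →ₗ[ℤ] MF' →ₗ[ℤ] ℚ := b.domRestrict₁₂ MF MF'
  have hb' : ∀ m m', b' m m' = B m m' := fun _ _ => rfl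
  exact (finrank_eq_of_sep (ratPairing b')
    (ratPairing_left b' fun a h => torsion_sub _ _ (r1 a a.2 fun c hc => h ⟨c, hc⟩))
    (ratPairing_right b' fun a h => torsion_sub _ _ (r2 a a.2 fun c hc => h ⟨c, hc⟩))).2
end

section
/- Let V and V' be finite-dimensional vector spaces over ℚ, let b : V × V' → ℚ be a non-degenerate bilinear form, and let f : V → V and f' : V' → V' be linear endomorphisms that are adjoint for b, i.e. b(f v, v') = b(v, f' v') for all v ∈ V, v' ∈ V'. If f is a semisimple endomorphism, then f' is a semisimple endomorphism. -/
/-- The frozen notion agrees with Mathlib's. -/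
theorem isSemisimpleEnd_iff {V : Type} [AddCommGroup V] [Module ℚ V]
    (f : V →ₗ[ℚ] V) : IsSemisimpleEnd f ↔ Module.End.IsSemisimple f := by
  rw [Module.End.isSemisimple_iff]
  rfl

/-- Polynomials in adjoint endomorphisms are adjoint. -/
theorem aeval_adjoint {V V' : Type}
    [AddCommGroup V] [Module ℚ V] [AddCommGroup V'] [Module ℚ V']
    (b : V →ₗ[ℚ] V' →ₗ[ℚ] ℚ)
    (f : Module.End ℚ V) (f' : Module.End ℚ V')
    (hadj : ∀ (v : V) (v' : V'), b (f v) v' = b v (f' v')) (p : Polynomial ℚ) :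
    ∀ (v : V) (v' : V'),
      b (Polynomial.aeval f p v) v' = b v (Polynomial.aeval f' p v') := by
  induction p using Polynomial.induction_on' with
  | add p q hp hq => intro v v'; simp [hp, hq]
  | monomial n a =>
    have h : ∀ (v : V) (v' : V'), b ((f ^ n) v) v' = b v ((f' ^ n) v') := by
      induction n with
      | zero => intro v v'; simp
      | succ n ih =>
        intro v v'
        rw [pow_succ, pow_succ', Module.End.mul_apply, Module.End.mul_apply, ih, hadj]
    intro v v'
    simp [Polynomial.aeval_monomial, h]

/-- Let `V, V'` be finite-dimensional `ℚ`-vector spaces, `b : V × V' → ℚ` a non-degenerate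
bilinear form, and `f, f'` endomorphisms that are adjoint for `b`.  If `f` is semisimple,
then so is `f'`. -/
theorem isSemisimple_adjoint {V V' : Type}
    [AddCommGroup V] [Module ℚ V] [FiniteDimensional ℚ V]
    [AddCommGroup V'] [Module ℚ V'] [FiniteDimensional ℚ V']
    (b : V →ₗ[ℚ] V' →ₗ[ℚ] ℚ)
    (hl : ∀ v : V, (∀ v' : V', b v v' = 0) → v = 0)
    (hr : ∀ v' : V', (∀ v : V, b v v' = 0) → v' = 0)
    (f : V →ₗ[ℚ] V) (f' : V' →ₗ[ℚ] V')
    (hadj : ∀ (v : V) (v' : V'), b (f v) v' = b v (f' v'))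
    (hf : IsSemisimpleEnd f) :
    IsSemisimpleEnd f' := by
  rw [isSemisimpleEnd_iff] at hf ⊢
  refine Module.End.isSemisimple_of_squarefree_aeval_eq_zero hf.minpoly_squarefree ?_
  ext v'
  refine hr _ fun v => ?_
  rw [← aeval_adjoint b f f' hadj, minpoly.aeval]
  simp
end

section
/- Let M be a finitely generated abelian group and g : M → M an endomorphism such that the induced ℚ-linear map g ⊗ ℚ : M ⊗ ℚ → M ⊗ ℚ is bijective. Then ker g and coker g = M/g(M) are finite, and |coker g| = |ker g| · |det(g ⊗ ℚ)|. -/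
open scoped TensorProduct

/-- The group-theoretic index computation. -/
theorem index_range_aux {M : Type} [AddCommGroup M] (g : M →+ M) (T : AddSubgroup M) [Finite T]
    (hK : g.ker ≤ T) (hT : T.map g = g.range ⊓ T) :
    g.range.index = Nat.card g.ker * (g.range ⊔ T).index := by
  rw [← AddSubgroup.relIndex_mul_index (le_sup_left : g.range ≤ g.range ⊔ T),
    AddSubgroup.relIndex_sup_left, ← AddSubgroup.inf_relIndex_right, ← hT]
  congr 1
  have h1 := AddSubgroup.relIndex_mul_relIndex ⊥ g.ker T bot_le hK
  have h2 := AddSubgroup.relIndex_mul_relIndex ⊥ (T.map g) T bot_le (hT ▸ inf_le_right)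
  rw [AddSubgroup.relIndex_ker] at h1
  simp only [AddSubgroup.relIndex_bot_left] at h1 h2
  have hle : T.map g ≤ T := hT ▸ inf_le_right
  have : Finite (T.map g) := Finite.of_injective _ (AddSubgroup.inclusion_injective hle)
  have hpos : 0 < Nat.card (T.map g) := Nat.card_pos
  apply Nat.eq_of_mul_eq_mul_left hpos
  rw [h2, ← h1, mul_comm]

theorem torsion_mkQ_baseChange_bijective (M : Type) [AddCommGroup M] :
    Function.Bijective ((Submodule.torsion ℤ M).mkQ.baseChange ℚ) := by
  set T := Submodule.torsion ℤ M
  constructor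
  · rw [injective_iff_map_eq_zero]
    intro x hx
    have hex := lTensor_exact (R := ℤ) ℚ (LinearMap.exact_subtype_mkQ T) T.mkQ_surjective
    obtain ⟨y, rfl⟩ := (hex x).1 hx
    have hy : y = 0 := by
      clear hx
      induction y using TensorProduct.induction_on with
      | zero => rfl
      | add a b ha hb => rw [ha, hb, add_zero]
      | tmul q t =>
        obtain ⟨n, hn⟩ := Submodule.torsion_isTorsion (R := ℤ) (M := M) (x := t)
        have hn0 : ((n : ℤ) : ℚ) ≠ 0 := by exact_mod_cast nonZeroDivisors.coe_ne_zero n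
        have : q = (n : ℤ) • (q / (n : ℤ)) := by
          rw [zsmul_eq_mul]; field_simp
        have hn' : (n : ℤ) • t = 0 := hn
        rw [this, TensorProduct.smul_tmul, hn', TensorProduct.tmul_zero]
    rw [hy, map_zero]
  · exact LinearMap.lTensor_surjective ℚ T.mkQ_surjective

theorem card_quotient_range_aux {F : Type} [AddCommGroup F] [Module.Free ℤ F] [Module.Finite ℤ F]
    (f : F →ₗ[ℤ] F) (hf : Function.Injective f) :
    Nat.card (F ⧸ LinearMap.range f) = (LinearMap.det f).natAbs := by
  rw [← Submodule.natAbs_det_equiv (LinearMap.range f) (LinearEquiv.ofInjective f hf)]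
  rfl

/-- Let `M` be a finitely generated abelian group and `g : M → M` an endomorphism such that
`g ⊗ ℚ` is bijective.  Then `ker g` and `coker g = M / g(M)` are finite, and
`|coker g| = |ker g| · |det (g ⊗ ℚ)|`. -/
theorem card_coker_eq_card_ker_mul_abs_det {M : Type}
    [AddCommGroup M] [Module.Finite ℤ M]
    (g : M →ₗ[ℤ] M)
    (hg : Function.Bijective (g.baseChange ℚ)) :
    Finite (LinearMap.ker g) ∧ Finite (M ⧸ LinearMap.range g) ∧
    (Nat.card (M ⧸ LinearMap.range g) : ℚ) =
      (Nat.card (LinearMap.ker g) : ℚ) * |LinearMap.det (g.baseChange ℚ)| := by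
  set T := Submodule.torsion ℤ M with hTdef
  have hTfin : Finite T := Module.finite_of_fg_torsion T Submodule.torsion_isTorsion
  have hgT : T ≤ T.comap g := by
    rintro x ⟨n, hn⟩
    refine ⟨n, ?_⟩
    have hn' : (n : ℤ) • x = 0 := hn
    change (n : ℤ) • g x = 0
    rw [← map_smul, hn', map_zero]
  let f : (M ⧸ T) →ₗ[ℤ] (M ⧸ T) := T.mapQ T g hgT
  have hfg : f ∘ₗ T.mkQ = T.mkQ ∘ₗ g := Submodule.mapQ_mkQ ..
  have hfx : ∀ x, f (T.mkQ x) = T.mkQ (g x) := fun x => rfl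
  let e := LinearEquiv.ofBijective _ (torsion_mkQ_baseChange_bijective M)
  have : Module.IsTorsionFree ℤ (M ⧸ T) := by infer_instance
  have : Module.Free ℤ (M ⧸ T) := inferInstance
  have hconj : f.baseChange ℚ = (e : _ →ₗ[ℚ] _) ∘ₗ g.baseChange ℚ ∘ₗ (e.symm : _ →ₗ[ℚ] _) := by
    have h1 : f.baseChange ℚ ∘ₗ (e : _ →ₗ[ℚ] _) = (e : _ →ₗ[ℚ] _) ∘ₗ g.baseChange ℚ := by
      change f.baseChange ℚ ∘ₗ T.mkQ.baseChange ℚ = T.mkQ.baseChange ℚ ∘ₗ g.baseChange ℚ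
      rw [← LinearMap.baseChange_comp, ← LinearMap.baseChange_comp, hfg]
    rw [← LinearMap.comp_assoc, ← h1, LinearMap.comp_assoc, LinearEquiv.comp_symm,
      LinearMap.comp_id]
  have hdet : LinearMap.det (g.baseChange ℚ) = ((LinearMap.det f : ℤ) : ℚ) := by
    have := LinearMap.det_baseChange (A := ℚ) f
    rw [hconj, LinearMap.det_conj] at this
    simpa using this
  have hdet0 : LinearMap.det f ≠ 0 := by
    intro h0
    have hu : IsUnit (LinearMap.det (g.baseChange ℚ)) :=
      (LinearEquiv.ofBijective _ hg).isUnit_det'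
    rw [hdet, h0] at hu
    simp at hu
  have hfinj : Function.Injective f := by
    rw [← LinearMap.ker_eq_bot]
    by_contra h
    exact hdet0 (LinearMap.det_eq_zero_iff_ker_ne_bot.2 h)
  have hmem : ∀ x, g x ∈ T → x ∈ T := by
    intro x hx
    rw [← Submodule.Quotient.mk_eq_zero] at hx ⊢
    apply hfinj
    rw [map_zero]
    exact hx
  have hker : LinearMap.ker g ≤ T := by
    intro x hx
    apply hmem
    rw [LinearMap.mem_ker.1 hx]
    exact T.zero_mem
  have hkerfin : Finite (LinearMap.ker g) :=
    Finite.of_injective _ (Submodule.inclusion_injective hker)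
  have hTf : Finite T.toAddSubgroup := hTfin
  have key := index_range_aux g.toAddMonoidHom T.toAddSubgroup hker (by
    ext y
    constructor
    · rintro ⟨x, hx, rfl⟩
      exact ⟨⟨x, rfl⟩, hgT hx⟩
    · rintro ⟨⟨x, rfl⟩, hx⟩
      exact ⟨x, hmem x hx, rfl⟩)
  have hsup : (g.toAddMonoidHom.range ⊔ T.toAddSubgroup).index = (LinearMap.det f).natAbs := by
    rw [← card_quotient_range_aux f hfinj]
    have h := AddSubgroup.index_map g.toAddMonoidHom.range T.mkQ.toAddMonoidHom
    have h1 : T.mkQ.toAddMonoidHom.ker = T.toAddSubgroup := by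
      ext x
      exact Submodule.Quotient.mk_eq_zero T
    have h2 : T.mkQ.toAddMonoidHom.range = ⊤ :=
      AddMonoidHom.range_eq_top.2 T.mkQ_surjective
    rw [h1, h2, AddSubgroup.index_top, mul_one] at h
    rw [← h]
    have h3 : g.toAddMonoidHom.range.map T.mkQ.toAddMonoidHom
        = (LinearMap.range f).toAddSubgroup := by
      ext y
      constructor
      · rintro ⟨_, ⟨x, rfl⟩, rfl⟩
        exact ⟨T.mkQ x, rfl⟩
      · rintro ⟨z, rfl⟩
        obtain ⟨x, rfl⟩ := T.mkQ_surjective z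
        exact ⟨g x, ⟨x, rfl⟩, rfl⟩
    rw [h3]
    rfl
  have hcard : Nat.card (M ⧸ LinearMap.range g)
      = Nat.card (LinearMap.ker g) * (LinearMap.det f).natAbs := by
    rw [← hsup]
    exact key
  refine ⟨hkerfin, ?_, ?_⟩
  · apply Nat.finite_of_card_ne_zero
    rw [hcard]
    exact mul_ne_zero Nat.card_pos.ne' (Int.natAbs_ne_zero.2 hdet0)
  · rw [hcard, hdet, Nat.cast_mul, Nat.cast_natAbs, Int.cast_abs]
end
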